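/- arXiv:1507.00914 — 4 statements merged into one kernel-verified Lean document; each statement's English description precedes it below -/
import Mathlib

section
/- Let m be a positive integer with q ≡ 1 (mod 2m), let a, b ∈ F_q^×, and let χ be a multiplicative character of F_q of order 2m. Then φ_{(m,m)}(a,b) = Σ_{x∈F_q} φ(x+a)·φ(x+b)·(Σ_{k=0}^{m−1} χ^{2k+1}(x)). -/
section MulCharOfGenerator

variable {F : Type*} [Field F]

/-- A multiplicative character maps a generator of `Fˣ` to a primitive root of unity of the
order of the character. -/
lemma MulChar.isPrimitiveRoot_apply_generator {R : Type*} [CommRing R] {g : Fˣ}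
    (hg : ∀ x, x ∈ Subgroup.zpowers g) (χ : MulChar F R) :
    IsPrimitiveRoot (χ (g : F)) (orderOf χ) := by
  have key (k : ℕ) : χ (g : F) ^ k = 1 ↔ χ ^ k = 1 := by
    rw [MulChar.eq_iff hg, MulChar.pow_apply_coe, MulChar.one_apply_coe]
  exact ⟨(key _).2 (pow_orderOf_eq_one χ), fun l hl ↦ orderOf_dvd_of_pow_eq_one ((key l).1 hl)⟩

variable [Fintype F]

/-- The `m`-th power of a character of order `2 * m` is the quadratic character. -/
lemma MulChar.quadraticChar_eq_pow_of_orderOf [DecidableEq F] {R : Type*} [CommRing R] [IsDomain R]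
    [CharZero R] (hF : ringChar F ≠ 2) {m : ℕ} (hm : 0 < m) {χ : MulChar F R}
    (hχ : orderOf χ = 2 * m) :
    (quadraticChar F).ringHomComp (Int.castRingHom R) = χ ^ m := by
  obtain ⟨g, hg⟩ := IsCyclic.exists_generator (α := Fˣ)
  have hprim := hχ ▸ χ.isPrimitiveRoot_apply_generator hg
  rw [MulChar.eq_iff hg, MulChar.pow_apply_coe, MulChar.ringHomComp_apply]
  have h₁ : χ (g : F) ^ m = -1 :=
    (IsPrimitiveRoot.pow (by lia) hprim (mul_comm 2 m)).eq_neg_one_of_two_right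
  have h₂ : quadraticChar F (g : F) = -1 := by
    refine (quadraticChar_dichotomy g.ne_zero).resolve_left fun h ↦ quadraticChar_ne_one hF ?_
    rw [MulChar.eq_iff hg, h, MulChar.one_apply_coe]
  simp [h₁, h₂]

/-- The number of `m`-th roots of a unit, as a sum over the powers of a character of order `m`. -/
lemma MulChar.card_filter_pow_eq_sum [DecidableEq F] {R : Type*} [CommRing R] [IsDomain R]
    {m : ℕ} (hm : 0 < m) {ψ : MulChar F R} (hψ : orderOf ψ = m) (y : Fˣ) :
    (({x : F | x ^ m = y} : Finset F).card : R) = ∑ k ∈ Finset.range m, ψ (y : F) ^ k := by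
  obtain ⟨g, hg⟩ := IsCyclic.exists_generator (α := Fˣ)
  have hprim := hψ ▸ ψ.isPrimitiveRoot_apply_generator hg
  have hdvd : m ∣ Fintype.card Fˣ := by
    rw [← hψ]
    exact orderOf_dvd_of_pow_eq_one ψ.pow_card_eq_one
  obtain ⟨d, hd⟩ := hdvd
  have hgord : IsPrimitiveRoot (g : F) (Fintype.card Fˣ) := by
    rw [← Nat.card_eq_fintype_card, ← orderOf_eq_card_of_forall_mem_zpowers hg,
      IsPrimitiveRoot.coe_units_iff]
    exact IsPrimitiveRoot.orderOf g
  have hζ : IsPrimitiveRoot ((g : F) ^ d) m :=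
    hgord.pow Fintype.card_pos (by rw [hd, mul_comm])
  have hcard : ({x : F | x ^ m = y} : Finset F).card =
      if ∃ z : F, z ^ m = y then m else 0 := by
    convert hζ.card_nthRoots (y : F)
    rw [← Multiset.toFinset_card_of_nodup (hζ.nthRoots_nodup y.ne_zero)]
    congr 1
    ext x
    simp [Polynomial.mem_nthRoots hm]
  rw [hcard]
  split_ifs with h
  · obtain ⟨z, hz⟩ := h
    have : ψ (y : F) = 1 := by
      have hzu : IsUnit z := by
        refine isUnit_iff_ne_zero.2 ?_
        rintro rfl
        exact y.ne_zero (by rw [← hz, zero_pow hm.ne'])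
      rw [← hz, map_pow, ← MulChar.pow_apply' ψ hm.ne', ← hψ, pow_orderOf_eq_one,
        MulChar.one_apply hzu]
    simp [this]
  · have hpow : ψ (y : F) ^ m = 1 := by
      rw [← MulChar.pow_apply_coe, ← hψ, pow_orderOf_eq_one, MulChar.one_apply_coe]
    have hne : ψ (y : F) ≠ 1 := by
      intro h1
      obtain ⟨j, rfl⟩ := (Submonoid.mem_powers_iff _ _).1 (mem_powers_iff_mem_zpowers.2 (hg y))
      rw [Units.val_pow_eq_pow_val, map_pow] at h1
      obtain ⟨i, rfl⟩ := hprim.dvd_of_pow_eq_one j h1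
      exact h ⟨(g : F) ^ i, by rw [← pow_mul, mul_comm, Units.val_pow_eq_pow_val]⟩
    have hgeom := mul_geom_sum (ψ (y : F)) m
    rw [hpow, sub_self] at hgeom
    simpa using ((mul_eq_zero.1 hgeom).resolve_left (sub_ne_zero.2 hne)).symm

/-- The quadratic character summed over the `m`-th roots of `y`, in terms of the odd powers of a
character of order `2 * m`. -/
lemma MulChar.sum_quadraticChar_filter_pow_eq [DecidableEq F] {R : Type*} [CommRing R] [IsDomain R]
    [CharZero R] (hF : ringChar F ≠ 2) {m : ℕ} (hm : 0 < m) {χ : MulChar F R}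
    (hχ : orderOf χ = 2 * m) (y : F) :
    ∑ x : F with x ^ m = y, ((quadraticChar F x : ℤ) : R) =
      ∑ k ∈ Finset.range m, (χ ^ (2 * k + 1)) y := by
  have hφ (x : F) : ((quadraticChar F x : ℤ) : R) = χ (x ^ m) := by
    rw [map_pow, ← MulChar.pow_apply' χ hm.ne', ← quadraticChar_eq_pow_of_orderOf hF hm hχ]
    rfl
  have hlhs : ∑ x : F with x ^ m = y, ((quadraticChar F x : ℤ) : R) =
      ({x : F | x ^ m = y} : Finset F).card * χ y := by
    rw [← nsmul_eq_mul, ← Finset.sum_const]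
    refine Finset.sum_congr rfl fun x hx ↦ ?_
    rw [hφ, (Finset.mem_filter.1 hx).2]
  rw [hlhs]
  rcases eq_or_ne y 0 with rfl | hy
  · simp
  have hψ : orderOf (χ ^ 2) = m := by
    rw [orderOf_pow_of_dvd two_ne_zero (hχ ▸ dvd_mul_right 2 m), hχ,
      Nat.mul_div_cancel_left m two_pos]
  have hc := card_filter_pow_eq_sum hm hψ (Units.mk0 y hy)
  rw [Units.val_mk0] at hc
  rw [hc, Finset.sum_mul]
  refine Finset.sum_congr rfl fun k _ ↦ ?_
  rw [MulChar.pow_apply' χ two_ne_zero, MulChar.pow_apply' χ (Nat.succ_ne_zero _), ← pow_mul,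
    pow_succ]

end MulCharOfGenerator


/-- Let `F = F_q` with `q` odd, `φ` its quadratic character, `m ≥ 1` with
`q ≡ 1 (mod 2m)`, `a, b ∈ F_q^×`, and `χ` a multiplicative character of `F_q` of order `2m`.
Then `φ_{(m,m)}(a,b) = ∑_{x ∈ F_q} φ(x+a)·φ(x+b)·(∑_{k=0}^{m−1} χ^{2k+1}(x))`, where
`φ_{(m,m)}(a,b) = ∑_x φ(x)·φ(xᵐ + a)·φ(xᵐ + b)`. -/
theorem phi_mm_eq_sum_over_characters
    {F : Type*} [Field F] [Fintype F] [DecidableEq F]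
    (hq : Odd (Fintype.card F)) (m : ℕ) (hm : 0 < m)
    (hqm : Fintype.card F % (2 * m) = 1)
    (a b : F) (ha : a ≠ 0) (hb : b ≠ 0)
    (χ : MulChar F ℂ) (hχ : orderOf χ = 2 * m) :
    (∑ x : F, ((quadraticChar F x : ℤ) : ℂ) * ((quadraticChar F (x ^ m + a) : ℤ) : ℂ) *
        ((quadraticChar F (x ^ m + b) : ℤ) : ℂ)) =
      ∑ x : F, ((quadraticChar F (x + a) : ℤ) : ℂ) * ((quadraticChar F (x + b) : ℤ) : ℂ) *
        (∑ k ∈ Finset.range m, (χ ^ (2 * k + 1)) x) := by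
  have hF : ringChar F ≠ 2 := fun h ↦ by
    have := FiniteField.even_card_of_char_two h
    have := Nat.odd_iff.1 hq
    lia
  rw [← Finset.sum_fiberwise Finset.univ (fun x : F ↦ x ^ m)]
  refine Finset.sum_congr rfl fun y _ ↦ ?_
  rw [← MulChar.sum_quadraticChar_filter_pow_eq hF hm hχ y, Finset.mul_sum]
  refine Finset.sum_congr rfl fun x hx ↦ ?_
  rw [(Finset.mem_filter.1 hx).2]
  ring
end

section
/- Let m be a positive integer with q ≡ 1 (mod 2m), let a, b ∈ F_q^× with a ≠ b, and let χ be a multiplicative character of F_q of order 2m. Then φ_{(m,m)}(a,b) = q·φ(−ab)·Σ_{k=0}^{m−1} χ^{2k+1}(−a)·₂F₁(φ, χ^{2k+1}; χ^{2k+1+m} | a/b). -/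
/-- The quadratic character of a finite field, as a `ℂ`-valued multiplicative character. -/
noncomputable def quadCharℂ (F : Type*) [Field F] [Fintype F] [DecidableEq F] : MulChar F ℂ :=
  (quadraticChar F).ringHomComp (Int.castRingHom ℂ)

/-- Greene's Gaussian hypergeometric series `₂F₁(A,B;C | x)` over the finite field `F`:
`₂F₁(A,B;C | x) = (C(−1)/(q(q−1))) · ∑_ψ J(Aψ, ψ⁻¹)·J(Bψ, C⁻¹ψ⁻¹)·ψ(x)`,
the sum running over all multiplicative characters `ψ` of `F`,
where `J(A,B) = ∑_x A(x)·B(1−x)` is the Jacobi sum. -/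
noncomputable def gauss2F1 {F : Type*} [Field F] [Fintype F]
    (A B C : MulChar F ℂ) (x : F) : ℂ :=
  haveI : Fintype (MulChar F ℂ) := Fintype.ofFinite _
  C (-1) / ((Fintype.card F : ℂ) * ((Fintype.card F : ℂ) - 1)) *
    ∑ ψ : MulChar F ℂ, jacobiSum (A * ψ) ψ⁻¹ * jacobiSum (B * ψ) (C⁻¹ * ψ⁻¹) * ψ x

open MulChar in
theorem sum_mulChar_apply {F : Type*} [Field F] [Fintype F] [Fintype (MulChar F ℂ)]
    [DecidableEq F] (a : F) :
    ∑ ψ : MulChar F ℂ, ψ a = if a = 1 then (Fintype.card F : ℂ) - 1 else 0 := by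
  split_ifs with h
  · subst h
    have hcard := card_eq_card_units_of_hasEnoughRootsOfUnity F ℂ
    rw [Nat.card_eq_fintype_card, Nat.card_eq_fintype_card, Fintype.card_units] at hcard
    simp [hcard, Nat.cast_sub Fintype.card_pos]
  · obtain ⟨η, hη⟩ := exists_apply_ne_one_of_hasEnoughRootsOfUnity F ℂ h
    refine eq_zero_of_mul_eq_self_left hη ?_
    rw [Finset.mul_sum]
    exact Fintype.sum_equiv (Equiv.mulLeft η) _ _ fun ψ => by simp [mul_apply]

theorem exists_isPrimitiveRoot_of_dvd_card_sub_one {F : Type*} [Field F] [Fintype F] {m : ℕ}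
    (hm : m ∣ Fintype.card F - 1) : ∃ ζ : F, IsPrimitiveRoot ζ m := by
  classical
  obtain ⟨g, hg⟩ := IsCyclic.exists_generator (α := Fˣ)
  have hog : orderOf g = Fintype.card F - 1 := by
    rw [orderOf_eq_card_of_forall_mem_zpowers hg, Nat.card_eq_fintype_card, Fintype.card_units]
  obtain ⟨d, hd⟩ := hm
  have hpos : 0 < Fintype.card F - 1 := Nat.sub_pos_of_lt Fintype.one_lt_card
  have h := (IsPrimitiveRoot.orderOf g).pow (hog ▸ hpos) (hog.trans (hd.trans (mul_comm m d)))
  exact ⟨_, IsPrimitiveRoot.coe_units_iff.mpr h⟩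

open MulChar in
theorem MulChar.apply_eq_one_iff_exists_pow {F : Type*} [Field F] [Fintype F] {m : ℕ}
    {η : MulChar F ℂ} (hη : orderOf η = m) {u : F} (hu : u ≠ 0) :
    η u = 1 ↔ ∃ v, v ^ m = u := by
  constructor
  · intro h
    obtain ⟨g, hg⟩ := IsCyclic.exists_generator (α := Fˣ)
    obtain ⟨j, hj⟩ := mem_powers_iff_mem_zpowers.mpr (hg (Units.mk0 u hu))
    have hju : (g : F) ^ j = u := by simpa using congrArg Units.val hj
    have h1 : η ^ j = 1 := (eq_iff hg _ _).mpr <| by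
      rw [pow_apply_coe, ← map_pow, hju, h, one_apply_coe]
    obtain ⟨d, rfl⟩ := hη ▸ orderOf_dvd_of_pow_eq_one h1
    exact ⟨(g : F) ^ d, by rw [← hju, ← pow_mul, mul_comm]⟩
  · rintro ⟨v, rfl⟩
    have hv : IsUnit v := by
      refine (isUnit_pow_iff ?_).mp hu.isUnit
      exact hη ▸ η.orderOf_pos.ne'
    obtain ⟨v, rfl⟩ := hv
    rw [map_pow, ← pow_apply_coe, ← hη, pow_orderOf_eq_one, one_apply_coe]

open MulChar in
theorem card_pow_eq_sum_mulChar {F : Type*} [Field F] [Fintype F] [DecidableEq F] {m : ℕ}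
    {η : MulChar F ℂ} (hη : orderOf η = m) {u : F} (hu : u ≠ 0) :
    ((Finset.univ.filter fun x : F => x ^ m = u).card : ℂ) = ∑ k ∈ Finset.range m, η u ^ k := by
  have hm : 0 < m := hη ▸ η.orderOf_pos
  obtain ⟨ζ, hζ⟩ := exists_isPrimitiveRoot_of_dvd_card_sub_one
    (hη ▸ η.orderOf_dvd_card_sub_one : m ∣ Fintype.card F - 1)
  have hcard : (Finset.univ.filter fun x : F => x ^ m = u).card =
      Multiset.card (Polynomial.nthRoots m u) := by
    rw [← Multiset.toFinset_card_of_nodup (hζ.nthRoots_nodup hu)]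
    congr 1
    ext x
    simp [Polynomial.mem_nthRoots hm]
  rw [hcard, hζ.card_nthRoots]
  by_cases h : η u = 1
  · rw [if_pos ((apply_eq_one_iff_exists_pow hη hu).mp h)]
    simp [h]
  · rw [if_neg (mt (apply_eq_one_iff_exists_pow hη hu).mpr h)]
    have h1 : η u ^ m = 1 := by
      rw [← map_pow]
      exact (apply_eq_one_iff_exists_pow hη (pow_ne_zero m hu)).mpr ⟨u, rfl⟩
    rw [geom_sum_eq h, h1, sub_self, zero_div, Nat.cast_zero]

theorem sum_comp_pow_eq {F : Type*} [Field F] [Fintype F] {m : ℕ}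
    {η : MulChar F ℂ} (hη : orderOf η = m) {f : F → ℂ} (hf : f 0 = 0) :
    ∑ x : F, f (x ^ m) = ∑ k ∈ Finset.range m, ∑ u : F, η u ^ k * f u := by
  classical
  rw [Finset.sum_comm, ← Finset.sum_fiberwise Finset.univ (fun x : F => x ^ m)]
  refine Finset.sum_congr rfl fun u _ => ?_
  rw [← Finset.sum_mul]
  rcases eq_or_ne u 0 with rfl | hu
  · rw [hf, mul_zero]
    exact Finset.sum_eq_zero fun x hx => by rw [(Finset.mem_filter.mp hx).2, hf]
  · rw [← card_pow_eq_sum_mulChar hη hu, ← nsmul_eq_mul]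
    exact Finset.sum_eq_card_nsmul fun x hx => by rw [(Finset.mem_filter.mp hx).2]

open MulChar in
theorem jacobiSum_mul_jacobiSum_mul_apply {F : Type*} [Field F] [Fintype F]
    (A B C ψ : MulChar F ℂ) (x : F) :
    jacobiSum (A * ψ) ψ⁻¹ * jacobiSum (B * ψ) (C⁻¹ * ψ⁻¹) * ψ x =
      ∑ z : F, ∑ y : F, A y * (B z * C⁻¹ (1 - z)) * ψ (x * y * z / ((1 - y) * (1 - z))) := by
  rw [mul_comm (jacobiSum (A * ψ) _), jacobiSum, jacobiSum, Finset.sum_mul_sum, Finset.sum_mul]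
  refine Finset.sum_congr rfl fun z _ => ?_
  rw [Finset.sum_mul]
  refine Finset.sum_congr rfl fun y _ => ?_
  simp only [mul_apply, div_eq_mul_inv, map_mul, mul_inv, inv_apply' ψ]
  ring

theorem sum_ite_mul_div_eq_one {F : Type*} [Field F] [Fintype F] [DecidableEq F]
    (A : MulChar F ℂ) {x z : F} (hx : x ≠ 0) (hz : z ≠ 0) (hz1 : z ≠ 1) :
    ∑ y : F, (if x * y * z / ((1 - y) * (1 - z)) = 1 then A y else 0) =
      A ((1 - z) / (1 - z + x * z)) := by
  have h1z : 1 - z ≠ 0 := sub_ne_zero.mpr hz1.symm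
  have key : ∀ y : F, x * y * z / ((1 - y) * (1 - z)) = 1 ↔
      1 - z + x * z ≠ 0 ∧ y = (1 - z) / (1 - z + x * z) := by
    intro y
    constructor
    · intro h
      have hne : (1 - y) * (1 - z) ≠ 0 := fun h0 => by simp [h0] at h
      rw [div_eq_one_iff_eq hne] at h
      have hy : y * (1 - z + x * z) = 1 - z := by linear_combination h
      have hd : 1 - z + x * z ≠ 0 := fun h0 => h1z (by rw [← hy, h0, mul_zero])
      exact ⟨hd, (eq_div_iff hd).mpr hy⟩
    · rintro ⟨hd, rfl⟩
      have h1 : 1 - (1 - z) / (1 - z + x * z) = x * z / (1 - z + x * z) := by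
        rw [one_sub_div hd, add_sub_cancel_left]
      rw [h1]
      have hxz : x * z ≠ 0 := mul_ne_zero hx hz
      rw [div_eq_one_iff_eq (mul_ne_zero (div_ne_zero hxz hd) h1z)]
      ring
  by_cases hd : 1 - z + x * z = 0
  · simp [key, hd, MulChar.map_zero]
  · simp [key, hd]

open MulChar in
/-- Greene's integral representation of `₂F₁`. -/
theorem gauss2F1_eq_sum {F : Type*} [Field F] [Fintype F]
    (A B C : MulChar F ℂ) {x : F} (hx : x ≠ 0) :
    gauss2F1 A B C x = B (-1) * C (-1) / (Fintype.card F : ℂ) *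
      ∑ w : F, B w * (B⁻¹ * C) (1 - w) * A⁻¹ (1 - x * w) := by
  classical
  have hsum : ∀ [Fintype (MulChar F ℂ)],
      ∑ ψ : MulChar F ℂ, jacobiSum (A * ψ) ψ⁻¹ * jacobiSum (B * ψ) (C⁻¹ * ψ⁻¹) * ψ x =
        ((Fintype.card F : ℂ) - 1) *
          ∑ z : F, A ((1 - z) / (1 - z + x * z)) * (B z * C⁻¹ (1 - z)) := by
    intro _
    simp_rw [jacobiSum_mul_jacobiSum_mul_apply]
    rw [Finset.sum_comm, Finset.mul_sum]
    refine Finset.sum_congr rfl fun z _ => ?_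
    rw [Finset.sum_comm]
    simp_rw [← Finset.mul_sum, sum_mulChar_apply]
    rcases eq_or_ne z 0 with rfl | hz
    · simp
    rcases eq_or_ne z 1 with rfl | hz1
    · simp
    rw [← sum_ite_mul_div_eq_one A hx hz hz1, Finset.sum_mul, Finset.mul_sum]
    refine Finset.sum_congr rfl fun y _ => ?_
    split_ifs <;> ring
  have hsubst : ∑ z : F, A ((1 - z) / (1 - z + x * z)) * (B z * C⁻¹ (1 - z)) =
      B (-1) * ∑ w : F, B w * (B⁻¹ * C) (1 - w) * A⁻¹ (1 - x * w) := by
    have hinv : ∀ z : F, z ≠ 1 → z / (z - 1) - 1 = (z - 1)⁻¹ := fun z hz => by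
      have := sub_ne_zero.mpr hz
      field_simp
      ring
    have hmaps : ∀ z : F, z ≠ 1 → z / (z - 1) ≠ 1 := fun z hz h =>
      inv_ne_zero (sub_ne_zero.mpr hz) (by rw [← hinv z hz, h, sub_self])
    have hinvol : ∀ z : F, z ≠ 1 → z / (z - 1) / (z / (z - 1) - 1) = z := fun z hz => by
      rw [hinv z hz, div_inv_eq_mul, div_mul_cancel₀ _ (sub_ne_zero.mpr hz)]
    rw [Finset.mul_sum,
      ← Finset.sum_erase (a := (1 : F)) _ (by simp),
      ← Finset.sum_erase (a := (1 : F)) (f := fun w => B (-1) * _) _ (by simp)]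
    refine Finset.sum_nbij' (fun z => z / (z - 1)) (fun z => z / (z - 1))
      (by simpa using hmaps) (by simpa using hmaps) (by simpa using hinvol)
      (by simpa using hinvol) fun z hz => ?_
    have hz1 : z ≠ 1 := Finset.ne_of_mem_erase hz
    have h1z : 1 - z ≠ 0 := sub_ne_zero.mpr hz1.symm
    have hz' : z - 1 ≠ 0 := sub_ne_zero.mpr hz1
    have e1 : 1 - z / (z - 1) = (1 - z)⁻¹ := by
      rw [← neg_sub, hinv z hz1, ← inv_neg, neg_sub]
    have e2 : (1 - x * (z / (z - 1)))⁻¹ = (1 - z) / (1 - z + x * z) := by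
      rw [← inv_div (1 - z + x * z), inv_inj, eq_div_iff h1z]
      linear_combination x * div_mul_cancel₀ z hz'
    have e3 : z = -1 * (z / (z - 1)) * (1 - z) := by
      field_simp
      ring
    rw [e1, inv_apply' A, e2, mul_apply, inv_apply' B, inv_apply' C, inv_inv]
    have e4 : B z = B (-1) * B (z / (z - 1)) * B (1 - z) := by
      rw [← map_mul, ← map_mul, ← e3]
    rw [e4]
    ring
  rw [gauss2F1, @hsum (Fintype.ofFinite _), hsubst]
  have hq1 : (Fintype.card F : ℂ) - 1 ≠ 0 :=
    sub_ne_zero.mpr (by exact_mod_cast Fintype.one_lt_card.ne')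
  have hq0 : (Fintype.card F : ℂ) ≠ 0 := by exact_mod_cast Fintype.card_ne_zero
  generalize ∑ w : F, B w * (B⁻¹ * C) (1 - w) * A⁻¹ (1 - x * w) = T
  field_simp

theorem quadCharℂ_ne_one {F : Type*} [Field F] [Fintype F] [DecidableEq F]
    (hF : ringChar F ≠ 2) : quadCharℂ F ≠ 1 :=
  (MulChar.ringHomComp_ne_one_iff (RingHom.injective_int _)).mpr (quadraticChar_ne_one hF)

theorem quadCharℂ_sq {F : Type*} [Field F] [Fintype F] [DecidableEq F] :
    quadCharℂ F ^ 2 = 1 := by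
  rw [quadCharℂ, MulChar.ringHomComp_pow, (quadraticChar_isQuadratic F).sq_eq_one,
    MulChar.ringHomComp_one]

open MulChar in
/-- The quadratic character is the only multiplicative character of order two. -/
theorem eq_quadCharℂ_of_sq_eq_one {F : Type*} [Field F] [Fintype F] [DecidableEq F]
    (hF : ringChar F ≠ 2) {η : MulChar F ℂ} (hη : η ^ 2 = 1) (hη1 : η ≠ 1) :
    η = quadCharℂ F := by
  obtain ⟨g, hg⟩ := IsCyclic.exists_generator (α := Fˣ)
  have hval : ∀ {θ : MulChar F ℂ}, θ ^ 2 = 1 → θ ≠ 1 → θ g = -1 := by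
    intro θ h2 h1
    have hsq : θ g ^ 2 = 1 := by rw [← pow_apply_coe, h2, one_apply_coe]
    refine (mul_self_eq_one_iff.mp ((sq _).symm.trans hsq)).resolve_left ?_
    rwa [← one_apply_coe (R' := ℂ) g, ← eq_iff hg]
  rw [eq_iff hg, hval hη hη1, hval quadCharℂ_sq (quadCharℂ_ne_one hF)]

open MulChar in
theorem sum_mulChar_mul_quadCharℂ {F : Type*} [Field F] [Fintype F] [DecidableEq F]
    (S : MulChar F ℂ) {a b : F} (ha : a ≠ 0) (hb : b ≠ 0) :
    ∑ u : F, S u * (quadCharℂ F (u + a) * quadCharℂ F (u + b)) =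
      (Fintype.card F : ℂ) * quadCharℂ F (-(a * b)) *
        (S (-a) * gauss2F1 (quadCharℂ F) S (S * quadCharℂ F) (a / b)) := by
  have hinv : (quadCharℂ F)⁻¹ = quadCharℂ F :=
    inv_eq_of_mul_eq_one_left (by rw [← sq, quadCharℂ_sq])
  have hq0 : (Fintype.card F : ℂ) ≠ 0 := by exact_mod_cast Fintype.card_ne_zero
  have hneg : ∀ θ : MulChar F ℂ, θ (-1) * θ (-1) = 1 := fun θ => by
    rw [← map_mul, neg_mul_neg, one_mul, map_one]
  rw [gauss2F1_eq_sum _ _ _ (div_ne_zero ha hb), inv_mul_cancel_left, hinv, mul_apply]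
  have hconst : ∀ T : ℂ, (Fintype.card F : ℂ) * quadCharℂ F (-(a * b)) *
      (S (-a) * (S (-1) * (S (-1) * quadCharℂ F (-1)) / (Fintype.card F : ℂ) * T)) =
      S (-a) * quadCharℂ F (a * b) * T := by
    intro T
    have h : quadCharℂ F (-(a * b)) = quadCharℂ F (-1) * quadCharℂ F (a * b) := by
      rw [← map_mul, neg_one_mul]
    rw [h]
    field_simp
    linear_combination (quadCharℂ F (a * b) * S (-a) * T) *
      ((S (-1) * S (-1)) * hneg (quadCharℂ F) + hneg S)
  rw [hconst, Finset.mul_sum]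
  refine (Fintype.sum_equiv (Equiv.mulLeft₀ (-a) (neg_ne_zero.mpr ha)) _ _ fun y => ?_).symm
  have e1 : -a * y + a = a * (1 - y) := by ring
  have e2 : -a * y + b = b * (1 - a / b * y) := by
    field_simp
    ring
  simp only [Equiv.mulLeft₀_apply, e1, e2, map_mul]
  ring

/-- Let `F = F_q` with `q` odd, `φ` its quadratic character, `m ≥ 1` with
`q ≡ 1 (mod 2m)`, `a, b ∈ F_q^×` with `a ≠ b`, and `χ` a multiplicative character of order
`2m`. Then
`φ_{(m,m)}(a,b) = q·φ(−ab)·∑_{k=0}^{m−1} χ^{2k+1}(−a)·₂F₁(φ, χ^{2k+1}; χ^{2k+1+m} | a/b)`,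
where `φ_{(m,m)}(a,b) = ∑_x φ(x)·φ(xᵐ + a)·φ(xᵐ + b)`. -/
theorem phi_mm_eq_hypergeometric
    {F : Type*} [Field F] [Fintype F] [DecidableEq F]
    (hq : Odd (Fintype.card F)) (m : ℕ) (hm : 0 < m)
    (hqm : Fintype.card F % (2 * m) = 1)
    (a b : F) (ha : a ≠ 0) (hb : b ≠ 0) (hab : a ≠ b)
    (χ : MulChar F ℂ) (hχ : orderOf χ = 2 * m) :
    (∑ x : F, (quadCharℂ F) x * (quadCharℂ F) (x ^ m + a) * (quadCharℂ F) (x ^ m + b)) =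
      (Fintype.card F : ℂ) * (quadCharℂ F) (-(a * b)) *
        ∑ k ∈ Finset.range m, (χ ^ (2 * k + 1)) (-a) *
          gauss2F1 (quadCharℂ F) (χ ^ (2 * k + 1)) (χ ^ (2 * k + 1 + m)) (a / b) := by
  have hF : ringChar F ≠ 2 := fun h =>
    Nat.not_even_iff_odd.mpr hq (FiniteField.even_card_iff_char_two.mp h |> Nat.even_iff.mpr)
  have hχm : χ ^ m = quadCharℂ F := by
    refine eq_quadCharℂ_of_sq_eq_one hF ?_ (pow_ne_one_of_lt_orderOf hm.ne' (by omega))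
    rw [← pow_mul, mul_comm, ← hχ, pow_orderOf_eq_one]
  have hχ2 : orderOf (χ ^ 2) = m := by
    rw [orderOf_pow_of_dvd two_ne_zero (by simp [hχ]), hχ, Nat.mul_div_cancel_left _ two_pos]
  have hL : ∀ x : F, quadCharℂ F x = χ (x ^ m) := fun x => by
    rw [← hχm, MulChar.pow_apply' _ hm.ne', map_pow]
  have hsum := sum_comp_pow_eq hχ2
    (f := fun u => χ u * (quadCharℂ F (u + a) * quadCharℂ F (u + b))) (by rw [χ.map_zero, zero_mul])
  calc _ = ∑ x : F, χ (x ^ m) * (quadCharℂ F (x ^ m + a) * quadCharℂ F (x ^ m + b)) :=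
        Finset.sum_congr rfl fun x _ => by rw [← hL, mul_assoc]
    _ = _ := hsum
    _ = _ := by
      rw [Finset.mul_sum]
      refine Finset.sum_congr rfl fun k _ => ?_
      rw [pow_add χ (2 * k + 1) m, hχm, ← sum_mulChar_mul_quadCharℂ _ ha hb]
      refine Finset.sum_congr rfl fun u _ => ?_
      rw [← mul_assoc, MulChar.pow_apply' χ two_ne_zero, MulChar.pow_apply' χ (by omega),
        ← pow_mul, ← pow_succ]
end

section
/- Let a, b ∈ F_q^× and set λ = a²/b. Assume λ ≠ −1. Then ψ_{(2,4)}(a,b) = Σ_{x∈F_q} φ(x² + a)·φ(x⁴ + b) = φ(−b)·Σ_{x∈F_q} φ((x−1)·(x² + λ)) + φ(−a)·Σ_{x∈F_q} φ((x−1)·(x² + λ^{−1})) − 1. -/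
open Finset in
/-- Over a finite field of odd characteristic, `y` has `χ(y) + 1` square roots. -/
theorem sum_comp_sq_eq_sum_quadraticChar_add_one_mul
    {F : Type*} [Field F] [Fintype F] [DecidableEq F] (hF : ringChar F ≠ 2) (f : F → ℤ) :
    ∑ x : F, f (x ^ 2) = ∑ y : F, (quadraticChar F y + 1) * f y := by
  rw [← sum_fiberwise univ (fun x : F ↦ x ^ 2)]
  refine sum_congr rfl fun y _ ↦ ?_
  have hcard := quadraticChar_card_sqrts hF y
  rw [show {x : F | x ^ 2 = y}.toFinset = univ.filter (fun x : F ↦ x ^ 2 = y) by ext; simp]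
    at hcard
  rw [← hcard, sum_congr rfl (g := fun _ ↦ f y) (fun x hx ↦ by rw [(mem_filter.mp hx).2])]
  simp

theorem quadraticChar_sq_mul {F : Type*} [Field F] [Fintype F] [DecidableEq F]
    {c : F} (hc : c ≠ 0) (x : F) : quadraticChar F (c ^ 2 * x) = quadraticChar F x := by
  rw [map_mul, quadraticChar_sq_one' hc, one_mul]

/-- The substitution `y = -a * x`. -/
theorem sum_quadraticChar_add_mul_sq_add
    {F : Type*} [Field F] [Fintype F] [DecidableEq F] {a : F} (b : F) (ha : a ≠ 0) :
    ∑ y : F, quadraticChar F ((y + a) * (y ^ 2 + b)) =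
      quadraticChar F (-a) *
        ∑ x : F, quadraticChar F ((x - 1) * (x ^ 2 + (a ^ 2 / b)⁻¹)) := by
  rw [Finset.mul_sum, ← Equiv.sum_comp (Equiv.mulLeft₀ (-a) (neg_ne_zero.mpr ha))]
  refine Finset.sum_congr rfl fun x _ ↦ ?_
  rw [← map_mul, ← quadraticChar_sq_mul ha (-a * _)]
  congr 1
  simp only [Equiv.mulLeft₀_apply]
  field_simp
  ring

/-- The substitution `y = -a / x`, which misses `x = 0`. -/
theorem sum_quadraticChar_mul_add_mul_sq_add
    {F : Type*} [Field F] [Fintype F] [DecidableEq F] {a b : F} (ha : a ≠ 0) (hb : b ≠ 0) :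
    ∑ y : F, quadraticChar F (y * ((y + a) * (y ^ 2 + b))) =
      quadraticChar F (-b) *
        ∑ x : F, quadraticChar F ((x - 1) * (x ^ 2 + a ^ 2 / b)) - 1 := by
  rw [Finset.mul_sum, ← Equiv.sum_comp ((Equiv.inv F).trans
    (Equiv.mulLeft₀ (-a) (neg_ne_zero.mpr ha))),
    ← Finset.add_sum_erase _ _ (Finset.mem_univ (0 : F)),
    ← Finset.add_sum_erase _ (fun x ↦ _ * _) (Finset.mem_univ (0 : F))]
  have h0 : quadraticChar F (-b) * quadraticChar F ((0 - 1) * (0 ^ 2 + a ^ 2 / b)) = 1 := by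
    rw [← map_mul, ← quadraticChar_sq_one' ha]
    congr 1
    field_simp
    ring
  rw [h0, add_sub_cancel_left]
  simp only [Equiv.trans_apply, Equiv.inv_apply, Equiv.mulLeft₀_apply, inv_zero, mul_zero,
    zero_mul, MulChar.map_zero, zero_add]
  refine Finset.sum_congr rfl fun x hx ↦ ?_
  have hx : x ≠ 0 := Finset.ne_of_mem_erase hx
  rw [← map_mul, ← quadraticChar_sq_mul (div_ne_zero ha (pow_ne_zero 2 hx)) (-b * _)]
  congr 1
  field_simp
  ring

/-- Let `F = F_q` with `q` odd, `φ` its quadratic character, `a, b ∈ F_q^×`,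
and set `λ = a²/b`; assume `λ ≠ −1`. Then
`ψ_{(2,4)}(a,b) = ∑_x φ(x² + a)·φ(x⁴ + b)
  = φ(−b)·∑_x φ((x−1)·(x² + λ)) + φ(−a)·∑_x φ((x−1)·(x² + λ⁻¹)) − 1`. -/
theorem psi24_eq_clausen_traces
    {F : Type*} [Field F] [Fintype F] [DecidableEq F]
    (hq : Odd (Fintype.card F)) (a b : F) (ha : a ≠ 0) (hb : b ≠ 0)
    (lam : F) (hlam : lam = a ^ 2 / b) (hlam' : lam ≠ -1) :
    (∑ x : F, ((quadraticChar F (x ^ 2 + a) : ℤ) : ℂ) *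
        ((quadraticChar F (x ^ 4 + b) : ℤ) : ℂ)) =
      ((quadraticChar F (-b) : ℤ) : ℂ) *
          (∑ x : F, ((quadraticChar F ((x - 1) * (x ^ 2 + lam)) : ℤ) : ℂ)) +
        ((quadraticChar F (-a) : ℤ) : ℂ) *
          (∑ x : F, ((quadraticChar F ((x - 1) * (x ^ 2 + lam⁻¹)) : ℤ) : ℂ)) - 1 := by
  have hF : ringChar F ≠ 2 := fun h ↦
    Nat.not_even_iff_odd.mpr hq (Nat.even_iff.mpr (FiniteField.even_card_iff_char_two.mp h))
  subst hlam
  have key : ∑ x : F, quadraticChar F (x ^ 2 + a) * quadraticChar F (x ^ 4 + b) =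
      quadraticChar F (-b) * ∑ x : F, quadraticChar F ((x - 1) * (x ^ 2 + a ^ 2 / b)) +
        quadraticChar F (-a) *
          ∑ x : F, quadraticChar F ((x - 1) * (x ^ 2 + (a ^ 2 / b)⁻¹)) - 1 := by
    calc
      _ = ∑ x : F, quadraticChar F ((x ^ 2 + a) * ((x ^ 2) ^ 2 + b)) := by
        simp only [map_mul, ← pow_mul, Nat.reduceMul]
      _ = ∑ y : F, (quadraticChar F y + 1) * quadraticChar F ((y + a) * (y ^ 2 + b)) :=
        sum_comp_sq_eq_sum_quadraticChar_add_one_mul hF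
          fun y ↦ quadraticChar F ((y + a) * (y ^ 2 + b))
      _ = _ := by
        simp only [add_one_mul, Finset.sum_add_distrib, ← map_mul]
        rw [sum_quadraticChar_add_mul_sq_add b ha, sum_quadraticChar_mul_add_mul_sq_add ha hb]
        ring
  exact_mod_cast key
end

section
/- Suppose q ≡ 1 (mod 4) and let χ be a multiplicative character of F_q of order 4. Let a, b ∈ F_q^× and set λ = a²/b; assume λ ≠ −1. Then ψ_{(2,4)}(a,b) = Σ_{x∈F_q} φ(x² + a)·φ(x⁴ + b) = q·φ(−b)·₂F₁(χ, χ³; ε | −λ) + q·φ(−a)·₂F₁(χ, χ³; ε | −λ^{−1}) − 1, where ε is the trivial character. -/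
section FiniteFieldCharacters

open Finset

theorem MulChar.apply_mul_apply_pow_three {F : Type*} [Field F] {χ : MulChar F ℂ}
    (hχ : orderOf χ = 4) {t : F} (ht : t ≠ 0) : χ t * (χ ^ 3) t = 1 := by
  have h4 : χ ^ 4 = 1 := hχ ▸ pow_orderOf_eq_one χ
  rw [← MulChar.mul_apply, ← pow_succ', h4, MulChar.one_apply ht.isUnit]

variable {F : Type*} [Field F] [Fintype F]

theorem MulChar.sum_apply_eq_ite [DecidableEq F] [Fintype (MulChar F ℂ)] (a : F) :
    ∑ ψ : MulChar F ℂ, ψ a = if a = 1 then (Fintype.card F : ℂ) - 1 else 0 := by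
  split_ifs with ha
  · have h := MulChar.card_eq_card_units_of_hasEnoughRootsOfUnity F ℂ
    rw [Nat.card_eq_fintype_card, Nat.card_eq_fintype_card, Fintype.card_units] at h
    simp [ha, h, Nat.cast_sub Fintype.card_pos]
  · obtain ⟨χ, hχ⟩ := MulChar.exists_apply_ne_one_of_hasEnoughRootsOfUnity F ℂ ha
    refine eq_zero_of_mul_eq_self_left hχ ?_
    simp only [Finset.mul_sum, ← MulChar.mul_apply]
    exact Fintype.sum_bijective _ (Group.mulLeft_bijective χ) _ _ fun _ ↦ rfl

variable [DecidableEq F]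

theorem quadCharℂ_apply (x : F) : quadCharℂ F x = (quadraticChar F x : ℂ) := rfl

theorem quadCharℂ_zero : quadCharℂ F 0 = 0 :=
  MulChar.map_zero _

theorem quadCharℂ_of_isSquare {x : F} (hx : x ≠ 0) (h : IsSquare x) : quadCharℂ F x = 1 := by
  rw [quadCharℂ_apply, (quadraticChar_one_iff_isSquare hx).2 h, Int.cast_one]

theorem quadCharℂ_of_not_isSquare {x : F} (h : ¬IsSquare x) : quadCharℂ F x = -1 := by
  rw [quadCharℂ_apply, quadraticChar_neg_one_iff_not_isSquare.2 h]
  simp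

theorem quadCharℂ_mul_sq {c : F} (hc : c ≠ 0) (x : F) :
    quadCharℂ F (x * c ^ 2) = quadCharℂ F x := by
  rw [map_mul, quadCharℂ_of_isSquare (pow_ne_zero 2 hc) (IsSquare.sq c), mul_one]

theorem quadCharℂ_mul_self {x : F} (hx : x ≠ 0) : quadCharℂ F x * quadCharℂ F x = 1 := by
  rw [← map_mul, quadCharℂ_of_isSquare (mul_ne_zero hx hx) ⟨x, rfl⟩]

theorem quadCharℂ_inv (x : F) : quadCharℂ F x⁻¹ = quadCharℂ F x := by
  rcases eq_or_ne x 0 with rfl | hx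
  · simp
  · rw [← quadCharℂ_mul_sq hx]
    congr 1
    field_simp

/-- If the product of two elements is a nonzero square, the quadratic character agrees on them. -/
theorem quadCharℂ_eq_of_mul_eq_sq {x y w : F} (hw : w ≠ 0) (h : x * y = w ^ 2) :
    quadCharℂ F x = quadCharℂ F y := by
  have hy : y ≠ 0 := by
    rintro rfl
    exact pow_ne_zero 2 hw (by rw [← h, mul_zero])
  rw [← quadCharℂ_mul_sq hy x, show x * y ^ 2 = y * w ^ 2 by rw [← h]; ring, quadCharℂ_mul_sq hw]

theorem card_sq_eq (hF : ringChar F ≠ 2) (a : F) :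
    ((#{x : F | x ^ 2 = a} : ℕ) : ℂ) = 1 + quadCharℂ F a := by
  have h := quadraticChar_card_sqrts hF a
  have h' : ({x : F | x ^ 2 = a} : Set F).toFinset = univ.filter fun x : F ↦ x ^ 2 = a := by
    ext; simp
  rw [h'] at h
  rw [quadCharℂ_apply, add_comm]
  exact_mod_cast h

theorem sum_comp_sq (hF : ringChar F ≠ 2) (f : F → ℂ) :
    ∑ x : F, f (x ^ 2) = ∑ y : F, (1 + quadCharℂ F y) * f y := by
  rw [← Finset.sum_fiberwise univ (fun x : F ↦ x ^ 2)]
  refine Finset.sum_congr rfl fun y _ ↦ ?_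
  rw [← card_sq_eq hF y, ← nsmul_eq_mul, ← Finset.sum_const]
  refine Finset.sum_congr rfl fun x hx ↦ ?_
  rw [(Finset.mem_filter.1 hx).2]

theorem card_quadratic_roots (hF : ringChar F ≠ 2) {A : F} (hA : A ≠ 0) (B C : F) :
    ((#{t : F | A * t ^ 2 + B * t + C = 0} : ℕ) : ℂ) = 1 + quadCharℂ F (B ^ 2 - 4 * A * C) := by
  have h2 : (2 : F) ≠ 0 := Ring.two_ne_zero hF
  have h2A : 2 * A ≠ 0 := mul_ne_zero h2 hA
  rw [← card_sq_eq hF]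
  congr 1
  refine Finset.card_bij (fun t _ ↦ 2 * A * t + B) ?_ ?_ ?_
  · intro t ht
    simp only [Finset.mem_filter, Finset.mem_univ, true_and] at ht ⊢
    linear_combination 4 * A * ht
  · intro s _ t _ h
    exact mul_left_cancel₀ h2A (add_right_cancel h)
  · intro y hy
    simp only [Finset.mem_filter, Finset.mem_univ, true_and] at hy
    refine ⟨(y - B) / (2 * A), ?_, ?_⟩
    · simp only [Finset.mem_filter, Finset.mem_univ, true_and]
      field_simp
      linear_combination hy
    · field_simp
      ring

theorem MulChar.sq_eq_quadCharℂ {χ : MulChar F ℂ} (hχ : orderOf χ = 4) :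
    χ ^ 2 = quadCharℂ F := by
  have h4 : χ ^ 4 = 1 := hχ ▸ pow_orderOf_eq_one χ
  have h2 : χ ^ 2 ≠ 1 := fun h ↦ by
    have := orderOf_le_of_pow_eq_one two_pos h
    omega
  have hsq : ∀ x : F, x ≠ 0 → IsSquare x → (χ ^ 2) x = 1 := by
    rintro x hx ⟨y, rfl⟩
    have hy : y ≠ 0 := left_ne_zero_of_mul hx
    rw [map_mul, ← MulChar.mul_apply, ← pow_add, h4, MulChar.one_apply hy.isUnit]
  obtain ⟨g, hg⟩ := MulChar.ne_one_iff.1 h2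
  have hg0 : (g : F) ≠ 0 := g.ne_zero
  have hgn : ¬IsSquare (g : F) := fun h ↦ hg (hsq _ hg0 h)
  have hg1 : (χ ^ 2) (g : F) = -1 := by
    refine (mul_self_eq_one_iff.1 ?_).resolve_left hg
    rw [← map_mul]
    exact hsq _ (mul_ne_zero hg0 hg0) ⟨_, rfl⟩
  ext x
  have hx : (x : F) ≠ 0 := x.ne_zero
  by_cases h : IsSquare (x : F)
  · rw [hsq _ hx h, quadCharℂ_of_isSquare hx h]
  · rw [quadCharℂ_of_not_isSquare h]
    have hgx : IsSquare ((g : F) * x) := by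
      rw [← quadraticChar_one_iff_isSquare (mul_ne_zero hg0 hx), map_mul,
        quadraticChar_neg_one_iff_not_isSquare.2 hgn, quadraticChar_neg_one_iff_not_isSquare.2 h]
      norm_num
    have := hsq _ (mul_ne_zero hg0 hx) hgx
    rw [map_mul, hg1] at this
    linear_combination -this

theorem card_mul_gauss2F1_eq_sum_sum (A B : MulChar F ℂ) (x : F) :
    (Fintype.card F : ℂ) * gauss2F1 A B 1 x =
      ∑ t : F, ∑ s : F, A s * B t *
        if s * t * (1 - s)⁻¹ * (1 - t)⁻¹ * x = 1 then 1 else 0 := by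
  have hq0 : (Fintype.card F : ℂ) ≠ 0 := by exact_mod_cast Fintype.card_ne_zero
  have hq1 : (Fintype.card F : ℂ) - 1 ≠ 0 :=
    sub_ne_zero.2 (by exact_mod_cast (Fintype.one_lt_card (α := F)).ne')
  let _ : Fintype (MulChar F ℂ) := Fintype.ofFinite _
  have key : ∑ ψ : MulChar F ℂ, jacobiSum (A * ψ) ψ⁻¹ * jacobiSum (B * ψ) (1⁻¹ * ψ⁻¹) * ψ x =
      ((Fintype.card F : ℂ) - 1) * ∑ t : F, ∑ s : F, A s * B t *
        if s * t * (1 - s)⁻¹ * (1 - t)⁻¹ * x = 1 then 1 else 0 := by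
    have expand (ψ : MulChar F ℂ) :
        jacobiSum (A * ψ) ψ⁻¹ * jacobiSum (B * ψ) (1⁻¹ * ψ⁻¹) * ψ x =
          ∑ t : F, ∑ s : F, A s * B t * ψ (s * t * (1 - s)⁻¹ * (1 - t)⁻¹ * x) := by
      rw [jacobiSum, jacobiSum, mul_comm (∑ _, _) (∑ _, _), Finset.sum_mul_sum, Finset.sum_mul]
      refine Finset.sum_congr rfl fun t _ ↦ ?_
      rw [Finset.sum_mul]
      refine Finset.sum_congr rfl fun s _ ↦ ?_
      simp only [inv_one, one_mul, MulChar.mul_apply, MulChar.inv_apply', map_mul]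
      ring
    simp_rw [expand]
    rw [Finset.sum_comm, Finset.mul_sum]
    refine Finset.sum_congr rfl fun t _ ↦ ?_
    rw [Finset.sum_comm, Finset.mul_sum]
    refine Finset.sum_congr rfl fun s _ ↦ ?_
    rw [← Finset.mul_sum, MulChar.sum_apply_eq_ite]
    split_ifs <;> ring
  rw [gauss2F1, key, MulChar.one_apply isUnit_one.neg, ← mul_assoc, ← mul_assoc,
    show (Fintype.card F : ℂ) * (1 / (Fintype.card F * ((Fintype.card F : ℂ) - 1))) *
      ((Fintype.card F : ℂ) - 1) = 1 by field_simp, one_mul]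

/-- The hypergeometric series `₂F₁(χ, χ³; ε | x)` for a quartic character `χ` as a sum twisted by
the quadratic character. -/
theorem card_mul_gauss2F1_quartic (hF : ringChar F ≠ 2) {χ : MulChar F ℂ} (hχ : orderOf χ = 4)
    {x : F} (hx0 : x ≠ 0) (hx1 : x ≠ 1) :
    (Fintype.card F : ℂ) * gauss2F1 χ (χ ^ 3) 1 x =
      ∑ u : F, χ u * quadCharℂ F ((u - 1) ^ 2 + 4 * u * x) := by
  have hχ1 : χ ≠ 1 := by
    rintro rfl
    simp at hχ
  rw [card_mul_gauss2F1_eq_sum_sum]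
  have inner (t : F) : (∑ s : F, χ s * (χ ^ 3) t *
      if s * t * (1 - s)⁻¹ * (1 - t)⁻¹ * x = 1 then 1 else 0) =
      ∑ u : F, χ u * if u * (x - 1) * t ^ 2 + (u + 1) * t + -1 = 0 then 1 else 0 := by
    rcases eq_or_ne t 0 with rfl | ht
    · simp
    · rw [← (mulRight_bijective₀ t ht).sum_comp]
      refine Finset.sum_congr rfl fun u _ ↦ ?_
      rcases eq_or_ne u 0 with rfl | hu
      · simp [MulChar.map_zero]
      have hiff : u * t * t * (1 - u * t)⁻¹ * (1 - t)⁻¹ * x = 1 ↔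
          u * (x - 1) * t ^ 2 + (u + 1) * t + -1 = 0 := by
        have hne : u * t ^ 2 * x ≠ 0 := mul_ne_zero (mul_ne_zero hu (pow_ne_zero 2 ht)) hx0
        constructor
        · intro h
          have h1 : 1 - u * t ≠ 0 := fun h' ↦ by simp [h'] at h
          have h2 : 1 - t ≠ 0 := fun h' ↦ by simp [h'] at h
          field_simp at h
          linear_combination h
        · intro h
          have h' : u * t ^ 2 * x = (1 - u * t) * (1 - t) := by linear_combination h
          rw [h'] at hne
          have h1 := left_ne_zero_of_mul hne
          have h2 := right_ne_zero_of_mul hne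
          field_simp
          linear_combination h'
      simp only [hiff, map_mul]
      rw [mul_assoc (χ u), MulChar.apply_mul_apply_pow_three hχ ht, mul_one]
  simp_rw [inner]
  rw [Finset.sum_comm]
  calc _ = ∑ u : F, (χ u + χ u * quadCharℂ F ((u - 1) ^ 2 + 4 * u * x)) := by
        refine Finset.sum_congr rfl fun u _ ↦ ?_
        rw [← Finset.mul_sum, Finset.sum_boole]
        rcases eq_or_ne u 0 with rfl | hu
        · simp [MulChar.map_zero]
        rw [card_quadratic_roots hF (mul_ne_zero hu (sub_ne_zero.2 hx1)), mul_add, mul_one]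
        congr 3
        ring
    _ = _ := by
        rw [Finset.sum_add_distrib, MulChar.sum_eq_zero_of_ne_one hχ1, zero_add]

theorem sum_quadCharℂ_sqrts (hF : ringChar F ≠ 2) {χ : MulChar F ℂ} (hχ : orderOf χ = 4) (u : F) :
    ∑ t : F with t ^ 2 = u, quadCharℂ F t = χ u + χ⁻¹ u := by
  have hsq := MulChar.sq_eq_quadCharℂ hχ
  have hsq' (t : F) : χ t ^ 2 = quadCharℂ F t := by
    rw [← hsq, MulChar.pow_apply' _ two_ne_zero]
  have hinv : χ⁻¹ = χ ^ 3 :=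
    inv_eq_of_mul_eq_one_right (by rw [← pow_succ', ← pow_orderOf_eq_one χ, hχ])
  rw [hinv, MulChar.pow_apply' _ three_ne_zero]
  by_cases hu : IsSquare u
  · obtain ⟨v, rfl⟩ := hu
    rcases eq_or_ne v 0 with rfl | hv
    · rw [Finset.sum_eq_single 0] <;> simp [MulChar.map_zero]
    have hvv : v ≠ -v := fun h ↦ hv (by
      have : 2 * v = 0 := by linear_combination h
      exact (mul_eq_zero.1 this).resolve_left (Ring.two_ne_zero hF))
    have hroots : univ.filter (fun t : F ↦ t ^ 2 = v * v) = {v, -v} := by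
      ext t
      simp [← pow_two, sq_eq_sq_iff_eq_or_eq_neg]
    rw [hroots, Finset.sum_pair hvv, ← hsq' v, ← hsq' (-v), map_mul]
    have h2 : quadCharℂ F v * quadCharℂ F v = 1 := quadCharℂ_mul_self hv
    have hneg : χ (-v) ^ 2 = χ (-1) ^ 2 * χ v ^ 2 := by rw [neg_eq_neg_one_mul, map_mul, mul_pow]
    rw [← hsq'] at h2
    have h1 : χ (-1) ^ 2 = 1 := by rw [← map_pow]; simp
    rw [hneg, h1]
    linear_combination (-χ v ^ 2) * h2
  · have hempty : univ.filter (fun t : F ↦ t ^ 2 = u) = ∅ := by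
      refine Finset.filter_eq_empty_iff.2 fun t _ h ↦ hu ⟨t, by rw [← h, pow_two]⟩
    have h := hsq' u
    rw [quadCharℂ_of_not_isSquare hu] at h
    rw [hempty, Finset.sum_empty]
    linear_combination -χ u * h

theorem two_mul_sum_quartic (hF : ringChar F ≠ 2) {χ : MulChar F ℂ} (hχ : orderOf χ = 4) (x : F) :
    2 * ∑ u : F, χ u * quadCharℂ F ((u - 1) ^ 2 + 4 * u * x) =
      ∑ t : F, quadCharℂ F t * quadCharℂ F ((t ^ 2 - 1) ^ 2 + 4 * t ^ 2 * x) := by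
  have hinv : ∑ u : F, χ u * quadCharℂ F ((u - 1) ^ 2 + 4 * u * x) =
      ∑ u : F, χ⁻¹ u * quadCharℂ F ((u - 1) ^ 2 + 4 * u * x) := by
    rw [← inv_involutive.bijective.sum_comp]
    refine Finset.sum_congr rfl fun u _ ↦ ?_
    rw [MulChar.inv_apply']
    rcases eq_or_ne u 0 with rfl | hu
    · simp
    rw [← quadCharℂ_mul_sq hu]
    congr 2
    field_simp
    ring
  rw [two_mul]
  nth_rw 2 [hinv]
  symm
  rw [← Finset.sum_fiberwise univ (fun t : F ↦ t ^ 2)]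
  rw [← Finset.sum_add_distrib]
  refine Finset.sum_congr rfl fun u _ ↦ ?_
  rw [← add_mul, ← sum_quadCharℂ_sqrts hF hχ, Finset.sum_mul]
  refine Finset.sum_congr rfl fun t ht ↦ ?_
  rw [(Finset.mem_filter.1 ht).2]

theorem sum_quadCharℂ_fiber (hF : ringChar F ≠ 2) {i : F} (hi : i * i = -1) (z : F) :
    ∑ t : F with t ^ 2 - 1 = 2 * i * z * t, quadCharℂ F t =
      quadCharℂ F (1 + z) + quadCharℂ F (1 - z) := by
  have h2 : (2 : F) ≠ 0 := Ring.two_ne_zero hF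
  have hi0 : i ≠ 0 := by
    rintro rfl
    simp at hi
  have hneg : quadCharℂ F (-1) = 1 :=
    quadCharℂ_of_isSquare (neg_ne_zero.2 one_ne_zero) ⟨i, hi.symm⟩
  by_cases h : IsSquare (1 - z ^ 2)
  · obtain ⟨w, hw⟩ := h
    have hroots : univ.filter (fun t : F ↦ t ^ 2 - 1 = 2 * i * z * t) =
        {w + i * z, -w + i * z} := by
      ext t
      simp only [Finset.mem_filter, Finset.mem_univ, true_and, Finset.mem_insert,
        Finset.mem_singleton]
      have : t ^ 2 - 1 - 2 * i * z * t = (t - (w + i * z)) * (t - (-w + i * z)) := by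
        linear_combination -hw - z ^ 2 * hi
      rw [← sub_eq_zero, this, mul_eq_zero, sub_eq_zero, sub_eq_zero]
    rw [hroots]
    rcases eq_or_ne w 0 with rfl | hw0
    · have hz : z = 1 ∨ z = -1 := mul_self_eq_one_iff.1 (by linear_combination -hw)
      have hval : quadCharℂ F i = quadCharℂ F 2 :=
        quadCharℂ_eq_of_mul_eq_sq (w := 1 + i) (fun h ↦ h2 (by
          have : i = -1 := by linear_combination h
          subst this
          linear_combination hi)) (by linear_combination -hi)
      rcases hz with rfl | rfl
      · simp [hval, one_add_one_eq_two, quadCharℂ_zero]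
      · have : quadCharℂ F (-i) = quadCharℂ F i := by
          rw [neg_eq_neg_one_mul, map_mul, hneg, one_mul]
        simp [hval, this, one_add_one_eq_two, quadCharℂ_zero]
    · have hne : w + i * z ≠ -w + i * z := fun h ↦ by
        have : 2 * w = 0 := by linear_combination h
        exact mul_ne_zero h2 hw0 this
      have hval (v : F) (hv : 1 - z ^ 2 = v * v) (hv0 : v ≠ 0) :
          quadCharℂ F (v + i * z) = quadCharℂ F (1 - z) := by
        have hz : 1 - z ≠ 0 := fun h ↦ hv0 (mul_self_eq_zero.1 (by
          rw [← hv]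
          linear_combination (1 + z) * h))
        have ht : (v + i * z) ^ 2 - 1 = 2 * i * z * (v + i * z) := by
          linear_combination -hv - z ^ 2 * hi
        have ht0 : v + i * z ≠ 0 := fun h ↦ by
          rw [h] at ht
          simp at ht
        have h1i : 1 + i ≠ 0 := fun h ↦ mul_ne_zero h2 hi0 (by
          linear_combination (1 + i) * h - hi)
        generalize v + i * z = t at ht ht0 ⊢
        have hp : t * (1 - z) * (1 + i) ^ 2 = (i * (t - i)) ^ 2 := by
          linear_combination (t * (1 - z) - (t - i) ^ 2 + 1) * hi + ht
        have hp' : t * (1 - z) = (i * (t - i) / (1 + i)) ^ 2 := by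
          rw [div_pow, ← hp]
          field_simp
        refine quadCharℂ_eq_of_mul_eq_sq (fun h0 ↦ mul_ne_zero ht0 hz ?_) hp'
        rw [hp', h0, zero_pow two_ne_zero]
      rw [Finset.sum_pair hne, hval w hw hw0, hval (-w) (by rw [hw]; ring) (neg_ne_zero.2 hw0)]
      congr 1
      exact quadCharℂ_eq_of_mul_eq_sq hw0 (by linear_combination hw)
  · have hempty : univ.filter (fun t : F ↦ t ^ 2 - 1 = 2 * i * z * t) = ∅ := by
      refine Finset.filter_eq_empty_iff.2 fun t _ ht ↦ h ⟨t - i * z, ?_⟩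
      linear_combination -ht - z ^ 2 * hi
    have hm : quadCharℂ F (1 + z) * quadCharℂ F (1 - z) = -1 := by
      rw [← map_mul, ← quadCharℂ_of_not_isSquare h]
      congr 1
      ring
    have hz : 1 + z ≠ 0 := fun h' ↦ by simp [h', quadCharℂ_zero] at hm
    have := quadCharℂ_mul_self hz
    rw [hempty, Finset.sum_empty]
    linear_combination (-quadCharℂ F (1 + z)) * hm + quadCharℂ F (1 - z) * this

theorem sum_quadCharℂ_mul_eq_sum_quartic (hF : ringChar F ≠ 2) (hI : IsSquare (-1 : F))
    {χ : MulChar F ℂ} (hχ : orderOf χ = 4) (m : F) :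
    ∑ z : F, quadCharℂ F (z + 1) * quadCharℂ F (z ^ 2 + m) =
      ∑ u : F, χ u * quadCharℂ F ((u - 1) ^ 2 + 4 * u * -m) := by
  obtain ⟨i, hi⟩ := hI
  have h2 : (2 : F) ≠ 0 := Ring.two_ne_zero hF
  have hi0 : i ≠ 0 := by
    rintro rfl
    simp at hi
  have h2i : 2 * i ≠ 0 := mul_ne_zero h2 hi0
  have hneg : ∑ z : F, quadCharℂ F (z + 1) * quadCharℂ F (z ^ 2 + m) =
      ∑ z : F, quadCharℂ F (1 - z) * quadCharℂ F (z ^ 2 + m) := by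
    rw [← neg_involutive.bijective.sum_comp]
    refine Finset.sum_congr rfl fun z _ ↦ ?_
    rw [neg_sq, neg_add_eq_sub]
  refine mul_left_cancel₀ (two_ne_zero (α := ℂ)) ?_
  rw [two_mul_sum_quartic hF hχ, two_mul]
  nth_rw 2 [hneg]
  symm
  rw [← Finset.sum_add_distrib,
    ← Finset.sum_fiberwise univ (fun t : F ↦ (t ^ 2 - 1) / (2 * i * t))]
  refine Finset.sum_congr rfl fun z _ ↦ ?_
  rw [← add_mul, add_comm z 1, ← sum_quadCharℂ_fiber hF hi.symm, Finset.sum_mul]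
  rw [Finset.sum_filter, Finset.sum_filter]
  refine Finset.sum_congr rfl fun t _ ↦ ?_
  rcases eq_or_ne t 0 with rfl | ht
  · simp [quadCharℂ_zero]
  have hiff : (t ^ 2 - 1) / (2 * i * t) = z ↔ t ^ 2 - 1 = 2 * i * z * t := by
    rw [div_eq_iff (mul_ne_zero h2i ht)]
    constructor <;> intro h <;> linear_combination h
  simp only [hiff]
  split_ifs with h
  · rw [h, ← quadCharℂ_mul_sq (mul_ne_zero h2i ht) (z ^ 2 + m)]
    congr 2
    linear_combination 4 * t ^ 2 * m * hi
  · rfl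

theorem sum_quadCharℂ_add_mul_sq_add {a b : F} (ha : a ≠ 0) :
    ∑ y : F, quadCharℂ F (y + a) * quadCharℂ F (y ^ 2 + b) =
      quadCharℂ F a * ∑ z : F, quadCharℂ F (z + 1) * quadCharℂ F (z ^ 2 + b / a ^ 2) := by
  rw [← (mulLeft_bijective₀ a ha).sum_comp, Finset.mul_sum]
  refine Finset.sum_congr rfl fun z _ ↦ ?_
  rw [show a * z + a = a * (z + 1) by ring, map_mul, mul_assoc,
    ← quadCharℂ_mul_sq ha (z ^ 2 + _)]
  congr 3
  field_simp

end FiniteFieldCharacters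

/-- Let `F = F_q` with `q ≡ 1 (mod 4)`, `φ` its quadratic character, and `χ`
a multiplicative character of order `4`. Let `a, b ∈ F_q^×`, set `λ = a²/b`, and assume
`λ ≠ −1`. Then `ψ_{(2,4)}(a,b) = ∑_x φ(x² + a)·φ(x⁴ + b)
  = q·φ(−b)·₂F₁(χ, χ³; ε | −λ) + q·φ(−a)·₂F₁(χ, χ³; ε | −λ⁻¹) − 1`,
where `ε` is the trivial character. -/
theorem psi24_eq_hypergeometric
    {F : Type*} [Field F] [Fintype F] [DecidableEq F]
    (hq : Fintype.card F % 4 = 1)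
    (χ : MulChar F ℂ) (hχ : orderOf χ = 4)
    (a b : F) (ha : a ≠ 0) (hb : b ≠ 0)
    (lam : F) (hlam : lam = a ^ 2 / b) (hlam' : lam ≠ -1) :
    (∑ x : F, (quadCharℂ F) (x ^ 2 + a) * (quadCharℂ F) (x ^ 4 + b)) =
      (Fintype.card F : ℂ) * (quadCharℂ F) (-b) *
          gauss2F1 χ (χ ^ 3) (1 : MulChar F ℂ) (-lam) +
        (Fintype.card F : ℂ) * (quadCharℂ F) (-a) *
          gauss2F1 χ (χ ^ 3) (1 : MulChar F ℂ) (-lam⁻¹) - 1 := by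
  have hF : ringChar F ≠ 2 := fun h ↦ by
    have := FiniteField.even_card_of_char_two h
    omega
  have hI : IsSquare (-1 : F) := FiniteField.isSquare_neg_one_iff.2 (by omega)
  have hneg (x : F) : quadCharℂ F (-x) = quadCharℂ F x := by
    rw [neg_eq_neg_one_mul, map_mul,
      quadCharℂ_of_isSquare (neg_ne_zero.2 one_ne_zero) hI, one_mul]
  have hlam0 : lam ≠ 0 := hlam ▸ div_ne_zero (pow_ne_zero 2 ha) hb
  have hinv : lam⁻¹ = b / a ^ 2 := by rw [hlam, inv_div]
  have hE : ∑ y : F, quadCharℂ F (y + a) * quadCharℂ F (y ^ 2 + b) =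
      quadCharℂ F a * (Fintype.card F * gauss2F1 χ (χ ^ 3) 1 (-lam⁻¹)) := by
    rw [sum_quadCharℂ_add_mul_sq_add ha, ← hinv, sum_quadCharℂ_mul_eq_sum_quartic hF hI hχ,
      card_mul_gauss2F1_quartic hF hχ (neg_ne_zero.2 (inv_ne_zero hlam0))]
    intro h
    exact hlam' (by rw [← inv_inv lam, neg_eq_iff_eq_neg.1 h, inv_neg, inv_one])
  have hE' : ∑ y : F, quadCharℂ F (y + a⁻¹) * quadCharℂ F (y ^ 2 + b⁻¹) =
      quadCharℂ F a * (Fintype.card F * gauss2F1 χ (χ ^ 3) 1 (-lam)) := by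
    rw [sum_quadCharℂ_add_mul_sq_add (inv_ne_zero ha),
      show b⁻¹ / a⁻¹ ^ 2 = lam by rw [hlam]; field_simp,
      sum_quadCharℂ_mul_eq_sum_quartic hF hI hχ,
      card_mul_gauss2F1_quartic hF hχ (neg_ne_zero.2 hlam0), quadCharℂ_inv]
    intro h
    exact hlam' (neg_eq_iff_eq_neg.1 h)
  have hswap : ∑ y : F, quadCharℂ F y * (quadCharℂ F (y + a) * quadCharℂ F (y ^ 2 + b)) =
      quadCharℂ F a * quadCharℂ F b *
        (∑ y : F, quadCharℂ F (y + a⁻¹) * quadCharℂ F (y ^ 2 + b⁻¹)) - 1 := by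
    rw [← inv_involutive.bijective.sum_comp, Finset.mul_sum,
      ← Finset.add_sum_erase _ _ (Finset.mem_univ (0 : F)),
      ← Finset.add_sum_erase Finset.univ (fun y ↦ quadCharℂ F a * _ * _) (Finset.mem_univ (0 : F))]
    have h0 : quadCharℂ F a * quadCharℂ F b *
        (quadCharℂ F (0 + a⁻¹) * quadCharℂ F (0 ^ 2 + b⁻¹)) = 1 := by
      rw [zero_add, zero_pow two_ne_zero, zero_add, quadCharℂ_inv, quadCharℂ_inv]
      linear_combination quadCharℂ F b * quadCharℂ F b * quadCharℂ_mul_self ha +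
        quadCharℂ_mul_self hb
    rw [h0, inv_zero, MulChar.map_zero, zero_mul, zero_add, add_sub_cancel_left]
    refine Finset.sum_congr rfl fun y hy ↦ ?_
    have hy0 : y ≠ 0 := (Finset.mem_erase.1 hy).1
    rw [← map_mul, ← map_mul, ← map_mul, ← map_mul, ← map_mul,
      ← quadCharℂ_mul_sq (pow_ne_zero 2 hy0)]
    congr 1
    field_simp
    ring
  have hsum := sum_comp_sq hF fun y : F ↦ quadCharℂ F (y + a) * quadCharℂ F (y ^ 2 + b)
  simp only [← pow_mul, Nat.reduceMul, add_mul, one_mul, Finset.sum_add_distrib] at hsum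
  rw [hsum, hswap, hE, hE', hneg, hneg]
  linear_combination (Fintype.card F * quadCharℂ F b * gauss2F1 χ (χ ^ 3) 1 (-lam)) *
    quadCharℂ_mul_self ha
end
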